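/- arXiv:1109.5950 — 2 statements merged into one kernel-verified Lean document; each statement's English description precedes it below -/
import Mathlib

section
/- Let V be a complex Banach space, n ∈ ℕ, and m, ρ ∈ ℝ. If (F_k)_{k∈ℕ} is a sequence in S^{m,ρ}(ℝ^n, V) that is Cauchy with respect to every symbol seminorm ‖·‖^{m,ρ}_μ (μ a multiindex), then there exists F ∈ S^{m,ρ}(ℝ^n, V) such that ‖F_k − F‖^{m,ρ}_μ → 0 as k → ∞ for every multiindex μ; i.e. the symbol space S^{m,ρ}(ℝ^n, V) is sequentially complete in the topology generated by its symbol seminorms. -/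
open Filter MeasureTheory

noncomputable def pder {n : ℕ} {V : Type*} [NormedAddCommGroup V] [NormedSpace ℝ V]
    (i : Fin n) (f : (Fin n → ℝ) → V) : (Fin n → ℝ) → V :=
  fun x => fderiv ℝ f x (Pi.single i 1)

noncomputable def mder {n : ℕ} {V : Type*} [NormedAddCommGroup V] [NormedSpace ℝ V]
    (μ : Fin n → ℕ) (f : (Fin n → ℝ) → V) : (Fin n → ℝ) → V :=
  (List.finRange n).foldr (fun i g => (pder i)^[μ i] g) f

def mOrder {n : ℕ} (μ : Fin n → ℕ) : ℕ := ∑ i, μ i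

noncomputable def symWt {n : ℕ} (m ρ : ℝ) (μ : Fin n → ℕ) (x : Fin n → ℝ) : ℝ :=
  (1 + ‖x‖ ^ 2) ^ (-(m - ρ * (mOrder μ : ℝ)) / 2)

noncomputable def symNorm {n : ℕ} {V : Type*} [NormedAddCommGroup V] [NormedSpace ℝ V]
    (m ρ : ℝ) (μ : Fin n → ℕ) (F : (Fin n → ℝ) → V) : ℝ :=
  ⨆ x : Fin n → ℝ, symWt m ρ μ x * ‖mder μ F x‖

def IsSymbol {n : ℕ} {V : Type*} [NormedAddCommGroup V] [NormedSpace ℝ V]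
    (m ρ : ℝ) (F : (Fin n → ℝ) → V) : Prop :=
  ContDiff ℝ (⊤ : ℕ∞) F ∧ ∀ μ : Fin n → ℕ, ∃ C : ℝ, ∀ x, symWt m ρ μ x * ‖mder μ F x‖ ≤ C

section Derivatives

variable {n : ℕ} {V : Type*} [NormedAddCommGroup V] [NormedSpace ℝ V]

lemma contDiff_pder {f : (Fin n → ℝ) → V} (hf : ContDiff ℝ (⊤ : ℕ∞) f) (i : Fin n) :
    ContDiff ℝ (⊤ : ℕ∞) (pder i f) :=
  (hf.fderiv_right (m := (⊤ : ℕ∞)) (by simp)).clm_apply contDiff_const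

lemma contDiff_iterate_pder {f : (Fin n → ℝ) → V} (hf : ContDiff ℝ (⊤ : ℕ∞) f) (i : Fin n)
    (k : ℕ) : ContDiff ℝ (⊤ : ℕ∞) ((pder i)^[k] f) := by
  induction k with
  | zero => exact hf
  | succ k ih => rw [Function.iterate_succ_apply']; exact contDiff_pder ih i

lemma contDiff_foldr_pder {f : (Fin n → ℝ) → V} (hf : ContDiff ℝ (⊤ : ℕ∞) f) (μ : Fin n → ℕ)
    (l : List (Fin n)) : ContDiff ℝ (⊤ : ℕ∞) (l.foldr (fun i g => (pder i)^[μ i] g) f) := by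
  induction l with
  | nil => exact hf
  | cons j l ih => exact contDiff_iterate_pder ih j _

lemma contDiff_mder {f : (Fin n → ℝ) → V} (hf : ContDiff ℝ (⊤ : ℕ∞) f) (μ : Fin n → ℕ) :
    ContDiff ℝ (⊤ : ℕ∞) (mder μ f) :=
  contDiff_foldr_pder hf μ _

lemma pder_sub {f g : (Fin n → ℝ) → V} (hf : ContDiff ℝ (⊤ : ℕ∞) f)
    (hg : ContDiff ℝ (⊤ : ℕ∞) g) (i : Fin n) : pder i (f - g) = pder i f - pder i g := by
  ext x
  simp only [pder, Pi.sub_apply]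
  rw [fderiv_sub (hf.differentiable (by simp) x) (hg.differentiable (by simp) x)]
  rfl

lemma iterate_pder_sub {f g : (Fin n → ℝ) → V} (hf : ContDiff ℝ (⊤ : ℕ∞) f)
    (hg : ContDiff ℝ (⊤ : ℕ∞) g) (i : Fin n) (k : ℕ) :
    (pder i)^[k] (f - g) = (pder i)^[k] f - (pder i)^[k] g := by
  induction k with
  | zero => rfl
  | succ k ih =>
    simp only [Function.iterate_succ_apply']
    rw [ih, pder_sub (contDiff_iterate_pder hf i k) (contDiff_iterate_pder hg i k)]

lemma mder_sub {f g : (Fin n → ℝ) → V} (hf : ContDiff ℝ (⊤ : ℕ∞) f)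
    (hg : ContDiff ℝ (⊤ : ℕ∞) g) (μ : Fin n → ℕ) : mder μ (f - g) = mder μ f - mder μ g := by
  unfold mder
  induction List.finRange n with
  | nil => rfl
  | cons j l ih =>
    simp only [List.foldr_cons]
    rw [ih, iterate_pder_sub (contDiff_foldr_pder hf μ l) (contDiff_foldr_pder hg μ l)]

lemma pder_comm {f : (Fin n → ℝ) → V} (hf : ContDiff ℝ (⊤ : ℕ∞) f) (i j : Fin n) :
    pder i (pder j f) = pder j (pder i f) := by
  have hd : Differentiable ℝ (fderiv ℝ f) :=
    (hf.fderiv_right (m := (⊤ : ℕ∞)) (by simp)).differentiable (by simp)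
  have key : ∀ (a b : Fin n) (x : Fin n → ℝ), pder a (pder b f) x =
      fderiv ℝ (fderiv ℝ f) x (Pi.single a 1) (Pi.single b 1) := by
    intro a b x
    unfold pder
    rw [fderiv_clm_apply (hd x) (differentiableAt_const _)]
    simp
  ext x
  rw [key, key]
  exact (hf.contDiffAt.isSymmSndFDerivAt (by
    rw [minSmoothness_of_isRCLikeNormedField]
    exact WithTop.coe_le_coe.2 (le_top : (2 : ℕ∞) ≤ ⊤))) _ _

lemma pder_iterate_comm {f : (Fin n → ℝ) → V} (hf : ContDiff ℝ (⊤ : ℕ∞) f) (i j : Fin n)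
    (k : ℕ) : pder i ((pder j)^[k] f) = (pder j)^[k] (pder i f) := by
  induction k with
  | zero => rfl
  | succ k ih =>
    simp only [Function.iterate_succ_apply']
    rw [pder_comm (contDiff_iterate_pder hf j k), ih]

lemma foldr_pder_add_single_of_notMem (f : (Fin n → ℝ) → V) (μ : Fin n → ℕ) (i : Fin n)
    {l : List (Fin n)} (hi : i ∉ l) :
    l.foldr (fun j g => (pder j)^[(μ + Pi.single i 1 : Fin n → ℕ) j] g) f =
      l.foldr (fun j g => (pder j)^[μ j] g) f := by
  induction l with
  | nil => rfl
  | cons j l ih =>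
    rw [List.mem_cons, not_or] at hi
    simp only [List.foldr_cons]
    rw [ih hi.2]
    simp [Pi.single_eq_of_ne (Ne.symm hi.1)]

lemma pder_foldr_pder {f : (Fin n → ℝ) → V} (hf : ContDiff ℝ (⊤ : ℕ∞) f) (μ : Fin n → ℕ)
    (i : Fin n) {l : List (Fin n)} (hl : l.Nodup) (hi : i ∈ l) :
    pder i (l.foldr (fun j g => (pder j)^[μ j] g) f) =
      l.foldr (fun j g => (pder j)^[(μ + Pi.single i 1 : Fin n → ℕ) j] g) f := by
  induction l with
  | nil => simp at hi
  | cons j l ih =>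
    rw [List.nodup_cons] at hl
    simp only [List.foldr_cons]
    by_cases hij : i = j
    · subst hij
      rw [foldr_pder_add_single_of_notMem f μ i hl.1, Pi.add_apply, Pi.single_eq_same,
        Function.iterate_succ_apply']
    · have hil : i ∈ l := by simpa [hij] using hi
      rw [pder_iterate_comm (contDiff_foldr_pder hf μ l), ih hl.2 hil]
      simp [Pi.single_eq_of_ne (Ne.symm hij)]

lemma pder_mder {f : (Fin n → ℝ) → V} (hf : ContDiff ℝ (⊤ : ℕ∞) f) (μ : Fin n → ℕ)
    (i : Fin n) : pder i (mder μ f) = mder (μ + Pi.single i 1) f :=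
  pder_foldr_pder hf μ i (List.nodup_finRange n) (List.mem_finRange i)

/-- A family of functions indexed by multiindices on which each partial derivative acts by raising
the index consists of the iterated partial derivatives of its member of index `0`. -/
lemma mder_eq_of_pder_eq {H : (Fin n → ℕ) → (Fin n → ℝ) → V}
    (hH : ∀ μ i, pder i (H μ) = H (μ + Pi.single i 1)) (μ : Fin n → ℕ) : mder μ (H 0) = H μ := by
  have iter : ∀ (i : Fin n) (k : ℕ) (ν : Fin n → ℕ),
      (pder i)^[k] (H ν) = H (ν + Pi.single i k) := by
    intro i k ν
    induction k with
    | zero => simp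
    | succ k ih => rw [Function.iterate_succ_apply', ih, hH, add_assoc, ← Pi.single_add]
  have fold : ∀ l : List (Fin n), l.foldr (fun i g => (pder i)^[μ i] g) (H 0) =
      H (l.map fun i => Pi.single i (μ i)).sum := by
    intro l
    induction l with
    | nil => rfl
    | cons j l ih =>
      simp only [List.foldr_cons, List.map_cons, List.sum_cons]
      rw [ih, iter, add_comm]
  unfold mder
  rw [fold, ← List.ofFn_eq_map, List.sum_ofFn, Finset.univ_sum_single]

/-- The linear map with prescribed values on the standard basis. -/
noncomputable def gradCLM (a : Fin n → V) : (Fin n → ℝ) →L[ℝ] V :=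
  ∑ i, (ContinuousLinearMap.proj (R := ℝ) (φ := fun _ : Fin n => ℝ) i).smulRight (a i)

lemma gradCLM_apply (a : Fin n → V) (v : Fin n → ℝ) : gradCLM a v = ∑ i, v i • a i := by
  simp [gradCLM]

lemma gradCLM_single (a : Fin n → V) (i : Fin n) : gradCLM a (Pi.single i 1) = a i := by
  simp [gradCLM_apply, Pi.single_apply]

lemma norm_gradCLM_sub_le (a b : Fin n → V) :
    ‖gradCLM a - gradCLM b‖ ≤ ∑ i, ‖a i - b i‖ := by
  refine ContinuousLinearMap.opNorm_le_bound _ (by positivity) fun v => ?_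
  rw [_root_.sub_apply, gradCLM_apply, gradCLM_apply, ← Finset.sum_sub_distrib,
    Finset.sum_mul]
  refine (norm_sum_le _ _).trans (Finset.sum_le_sum fun i _ => ?_)
  rw [← smul_sub, norm_smul, mul_comm]
  gcongr
  exact norm_le_pi_norm v i

lemma fderiv_eq_gradCLM (f : (Fin n → ℝ) → V) (x : Fin n → ℝ) :
    fderiv ℝ f x = gradCLM fun i => pder i f x := by
  ext v
  rw [gradCLM_apply]
  conv_lhs => rw [pi_eq_sum_univ' v]
  simp [pder, Pi.single]

/-- A family closed under taking gradients is smooth. -/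
lemma contDiff_of_hasFDerivAt_gradCLM {H : (Fin n → ℕ) → (Fin n → ℝ) → V}
    (hH : ∀ μ x, HasFDerivAt (H μ) (gradCLM fun i => H (μ + Pi.single i 1) x) x)
    (μ : Fin n → ℕ) : ContDiff ℝ (⊤ : ℕ∞) (H μ) := by
  rw [contDiff_infty]
  intro k
  induction k generalizing μ with
  | zero =>
    exact contDiff_zero.2 (continuous_iff_continuousAt.2 fun x => (hH μ x).continuousAt)
  | succ k ih =>
    refine contDiff_succ_iff_hasFDerivAt.2 ⟨_, ?_, hH μ⟩
    unfold gradCLM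
    exact ContDiff.sum fun i _ => contDiff_const.smulRight (ih _)

end Derivatives

section Weight

variable {n : ℕ}

lemma symWt_pos (m ρ : ℝ) (μ : Fin n → ℕ) (x : Fin n → ℝ) : 0 < symWt m ρ μ x :=
  Real.rpow_pos_of_pos (by positivity) _

lemma continuous_symWt (m ρ : ℝ) (μ : Fin n → ℕ) : Continuous (symWt m ρ μ) := by
  unfold symWt
  refine Continuous.rpow_const (by fun_prop) fun x => Or.inl ?_
  positivity

variable {V : Type*} [NormedAddCommGroup V]

/-- A sequence that is Cauchy for a weighted supremum norm with positive weight converges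
in that norm. -/
lemma exists_weighted_limit [CompleteSpace V] {X : Type*} {w : X → ℝ} (hw : ∀ x, 0 < w x)
    {f : ℕ → X → V}
    (hf : ∀ ε : ℝ, 0 < ε → ∃ N, ∀ k l, N ≤ k → N ≤ l → ∀ x, w x * ‖f k x - f l x‖ < ε) :
    ∃ g : X → V, ∀ ε : ℝ, 0 < ε → ∃ N, ∀ k, N ≤ k → ∀ x, w x * ‖f k x - g x‖ ≤ ε := by
  have hc : ∀ x, CauchySeq fun k => f k x := by
    intro x
    refine Metric.cauchySeq_iff.2 fun ε hε => ?_
    obtain ⟨N, hN⟩ := hf (w x * ε) (mul_pos (hw x) hε)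
    refine ⟨N, fun k hk l hl => ?_⟩
    rw [dist_eq_norm]
    exact lt_of_mul_lt_mul_left (hN k l hk hl x) (hw x).le
  choose g hg using fun x => cauchySeq_tendsto_of_complete (hc x)
  refine ⟨g, fun ε hε => ?_⟩
  obtain ⟨N, hN⟩ := hf ε hε
  refine ⟨N, fun k hk x => ?_⟩
  refine le_of_tendsto (((tendsto_const_nhds.sub (hg x)).norm).const_mul (w x)) ?_
  filter_upwards [eventually_ge_atTop N] with l hl
  exact (hN k l hk hl x).le

/-- Convergence in a weighted supremum norm with positive continuous weight is locally uniform. -/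
lemma tendsto_norm_sub_of_weighted {X : Type*} [TopologicalSpace X] {w : X → ℝ}
    (hw : ∀ x, 0 < w x) (hwc : Continuous w) {f : ℕ → X → V} {g : X → V}
    (hg : ∀ ε : ℝ, 0 < ε → ∃ N, ∀ k, N ≤ k → ∀ x, w x * ‖f k x - g x‖ ≤ ε) (x : X) :
    Tendsto (fun p : ℕ × X => ‖f p.1 p.2 - g p.2‖) (atTop ×ˢ nhds x) (nhds 0) := by
  have h1 : Tendsto (fun p : ℕ × X => w p.2 * ‖f p.1 p.2 - g p.2‖) (atTop ×ˢ nhds x)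
      (nhds 0) := by
    refine Metric.tendsto_nhds.2 fun ε hε => ?_
    obtain ⟨N, hN⟩ := hg (ε / 2) (half_pos hε)
    filter_upwards [tendsto_fst.eventually (eventually_ge_atTop N)] with p hp
    rw [Real.dist_eq, sub_zero, abs_of_nonneg (mul_nonneg (hw _).le (norm_nonneg _))]
    exact (hN p.1 hp p.2).trans_lt (half_lt_self hε)
  have h2 : Tendsto (fun p : ℕ × X => (w p.2)⁻¹) (atTop ×ˢ nhds x) (nhds (w x)⁻¹) :=
    ((hwc.tendsto x).comp tendsto_snd).inv₀ (hw x).ne'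
  have h3 := h2.mul h1
  rw [mul_zero] at h3
  refine h3.congr fun p => ?_
  rw [inv_mul_cancel_left₀ (hw p.2).ne']

end Weight

section Symbols

variable {n : ℕ} {V : Type*} [NormedAddCommGroup V] [NormedSpace ℝ V] {m ρ : ℝ}

lemma IsSymbol.sub {f g : (Fin n → ℝ) → V} (hf : IsSymbol m ρ f) (hg : IsSymbol m ρ g) :
    IsSymbol m ρ (f - g) := by
  refine ⟨hf.1.sub hg.1, fun μ => ?_⟩
  obtain ⟨C, hC⟩ := hf.2 μ
  obtain ⟨D, hD⟩ := hg.2 μ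
  refine ⟨C + D, fun x => ?_⟩
  rw [mder_sub hf.1 hg.1, Pi.sub_apply]
  calc symWt m ρ μ x * ‖mder μ f x - mder μ g x‖
      ≤ symWt m ρ μ x * (‖mder μ f x‖ + ‖mder μ g x‖) :=
        mul_le_mul_of_nonneg_left (norm_sub_le _ _) (symWt_pos m ρ μ x).le
    _ ≤ C + D := by rw [mul_add]; exact add_le_add (hC x) (hD x)

lemma IsSymbol.le_symNorm {f : (Fin n → ℝ) → V} (hf : IsSymbol m ρ f) (μ : Fin n → ℕ)
    (x : Fin n → ℝ) : symWt m ρ μ x * ‖mder μ f x‖ ≤ symNorm m ρ μ f := by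
  obtain ⟨C, hC⟩ := hf.2 μ
  exact le_ciSup (f := fun x => symWt m ρ μ x * ‖mder μ f x‖)
    ⟨C, Set.forall_mem_range.2 hC⟩ x

end Symbols

theorem statement0 {n : ℕ} {V : Type*} [NormedAddCommGroup V] [NormedSpace ℝ V]
    [NormedSpace ℂ V] [IsScalarTower ℝ ℂ V] [CompleteSpace V]
    (m ρ : ℝ) (F : ℕ → (Fin n → ℝ) → V)
    (hF : ∀ k, IsSymbol m ρ (F k))
    (hCauchy : ∀ μ : Fin n → ℕ, ∀ ε : ℝ, 0 < ε → ∃ N : ℕ, ∀ k l : ℕ, N ≤ k → N ≤ l →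
      symNorm m ρ μ (fun x => F k x - F l x) < ε) :
    ∃ G : (Fin n → ℝ) → V, IsSymbol m ρ G ∧
      ∀ μ : Fin n → ℕ,
        Tendsto (fun k => symNorm m ρ μ (fun x => F k x - G x)) atTop (nhds 0) := by
  have hC : ∀ μ : Fin n → ℕ, ∀ ε : ℝ, 0 < ε → ∃ N : ℕ, ∀ k l : ℕ, N ≤ k → N ≤ l →
      ∀ x, symWt m ρ μ x * ‖mder μ (F k) x - mder μ (F l) x‖ < ε := by
    intro μ ε hε
    obtain ⟨N, hN⟩ := hCauchy μ ε hε
    refine ⟨N, fun k l hk hl x => lt_of_le_of_lt ?_ (hN k l hk hl)⟩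
    have h := ((hF k).sub (hF l)).le_symNorm μ x
    rwa [mder_sub (hF k).1 (hF l).1] at h
  choose H hH using fun μ => exists_weighted_limit (symWt_pos m ρ μ) (hC μ)
  have hlim : ∀ μ x, Tendsto (fun p : ℕ × (Fin n → ℝ) => ‖mder μ (F p.1) p.2 - H μ p.2‖)
      (atTop ×ˢ nhds x) (nhds 0) := fun μ x =>
    tendsto_norm_sub_of_weighted (symWt_pos m ρ μ) (continuous_symWt m ρ μ) (hH μ) x
  have hder : ∀ μ x, HasFDerivAt (H μ) (gradCLM fun i => H (μ + Pi.single i 1) x) x := by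
    intro μ x
    refine hasFDerivAt_of_tendstoUniformlyOnFilter (l := atTop)
      (f := fun k => mder μ (F k))
      (f' := fun k y => gradCLM fun i => mder (μ + Pi.single i 1) (F k) y)
      (g' := fun y => gradCLM fun i => H (μ + Pi.single i 1) y) ?_ ?_ ?_
    · have hsum : Tendsto (fun p : ℕ × (Fin n → ℝ) => ∑ i,
          ‖mder (μ + Pi.single i 1) (F p.1) p.2 - H (μ + Pi.single i 1) p.2‖)
          (atTop ×ˢ nhds x) (nhds 0) := by
        simpa using tendsto_finsetSum Finset.univ fun i _ => hlim (μ + Pi.single i 1) x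
      refine Metric.tendstoUniformlyOnFilter_iff.2 fun ε hε => ?_
      filter_upwards [hsum.eventually (gt_mem_nhds hε)] with p hp
      rw [dist_comm, dist_eq_norm]
      exact (norm_gradCLM_sub_le _ _).trans_lt hp
    · refine Eventually.of_forall fun p => ?_
      have h := ((contDiff_mder (hF p.1).1 μ).differentiable (by simp) p.2).hasFDerivAt
      rw [fderiv_eq_gradCLM] at h
      simpa only [pder_mder (hF p.1).1] using h
    · refine Eventually.of_forall fun y => tendsto_iff_norm_sub_tendsto_zero.2 ?_
      exact (hlim μ y).comp (tendsto_id.prodMk (tendsto_const_nhds (x := y)))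
  have hmder : ∀ μ, mder μ (H 0) = H μ := mder_eq_of_pder_eq fun μ i => by
    ext x
    rw [pder, (hder μ x).fderiv, gradCLM_single]
  have hsmooth : ContDiff ℝ (⊤ : ℕ∞) (H 0) := contDiff_of_hasFDerivAt_gradCLM hder 0
  refine ⟨H 0, ⟨hsmooth, fun μ => ?_⟩, fun μ => ?_⟩
  · obtain ⟨N, hN⟩ := hH μ 1 one_pos
    obtain ⟨C, hC⟩ := (hF N).2 μ
    refine ⟨C + 1, fun x => ?_⟩
    rw [hmder]
    calc symWt m ρ μ x * ‖H μ x‖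
        ≤ symWt m ρ μ x * (‖mder μ (F N) x‖ + ‖mder μ (F N) x - H μ x‖) :=
          mul_le_mul_of_nonneg_left (norm_le_norm_add_norm_sub _ _) (symWt_pos m ρ μ x).le
      _ ≤ C + 1 := by rw [mul_add]; exact add_le_add (hC x) (hN N le_rfl x)
  · refine Metric.tendsto_atTop.2 fun ε hε => ?_
    obtain ⟨N, hN⟩ := hH μ (ε / 2) (half_pos hε)
    refine ⟨N, fun k hk => ?_⟩
    have hle : symNorm m ρ μ (F k - H 0) ≤ ε / 2 := by
      refine ciSup_le fun x => ?_
      rw [mder_sub (hF k).1 hsmooth, hmder]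
      exact hN k hk x
    have hnonneg : 0 ≤ symNorm m ρ μ (F k - H 0) :=
      Real.iSup_nonneg fun x => mul_nonneg (symWt_pos m ρ μ x).le (norm_nonneg _)
    change dist (symNorm m ρ μ (F k - H 0)) 0 < ε
    rw [Real.dist_eq, sub_zero, abs_of_nonneg hnonneg]
    exact hle.trans_lt (half_lt_self hε)
end

section
/- Let χ : ℝ^n → ℝ be a compactly supported smooth function such that χ = 1 on the closed ball of radius r > 0 around 0 and supp χ is contained in the closed ball of radius R, with 0 < r < R. For ε > 0 set χ_ε(x) := χ(εx). Then for all m > 0 and ρ ≤ 1 and every multiindex μ ∈ ℕ^n, the symbol seminorm ‖χ_ε − 1‖^{m,ρ}_μ tends to 0 as ε → 0⁺; i.e. χ_ε converges to the constant function 1 in the topology of S^{m,ρ}(ℝ^n, ℂ). -/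
open Filter MeasureTheory

theorem pder_const_smul {n : ℕ} {V : Type*} [NormedAddCommGroup V] [NormedSpace ℝ V]
    (i : Fin n) (c : ℝ) (f : (Fin n → ℝ) → V) : pder i (c • f) = c • pder i f := by
  funext x
  simp [pder, fderiv_const_smul_field]

theorem pder_comp_smul {n : ℕ} {V : Type*} [NormedAddCommGroup V] [NormedSpace ℝ V]
    (i : Fin n) (c : ℝ) (f : (Fin n → ℝ) → V) :
    pder i (fun x => f (c • x)) = c • fun x => pder i f (c • x) := by
  funext x
  simp [pder, fderiv_comp_smul]

theorem iterate_pder_scale {n : ℕ} {V : Type*} [NormedAddCommGroup V] [NormedSpace ℝ V]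
    (i : Fin n) (c a : ℝ) (k : ℕ) (f : (Fin n → ℝ) → V) :
    (pder i)^[k] (a • fun x => f (c • x)) = (c ^ k * a) • fun x => (pder i)^[k] f (c • x) := by
  induction k with
  | zero => simp
  | succ k ih =>
    rw [Function.iterate_succ_apply', ih, pder_const_smul, pder_comp_smul, smul_smul]
    simp only [Function.iterate_succ_apply']
    congr 1
    ring

theorem mder_comp_smul {n : ℕ} {V : Type*} [NormedAddCommGroup V] [NormedSpace ℝ V]
    (μ : Fin n → ℕ) (c : ℝ) (f : (Fin n → ℝ) → V) :
    mder μ (fun x => f (c • x)) = c ^ mOrder μ • fun x => mder μ f (c • x) := by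
  have key (L : List (Fin n)) :
      L.foldr (fun i g => (pder i)^[μ i] g) (fun x => f (c • x)) =
        c ^ (L.map μ).sum • fun x => L.foldr (fun i g => (pder i)^[μ i] g) f (c • x) := by
    induction L with
    | nil => simp
    | cons i L ih =>
      simp only [List.foldr_cons, ih, iterate_pder_scale, List.map_cons, List.sum_cons, pow_add]
  simpa [mder, mOrder, Fin.sum_univ_def] using key (List.finRange n)

theorem ContDiff.pder {n : ℕ} {V : Type*} [NormedAddCommGroup V] [NormedSpace ℝ V]
    (i : Fin n) {f : (Fin n → ℝ) → V} (hf : ContDiff ℝ (⊤ : ℕ∞) f) :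
    ContDiff ℝ (⊤ : ℕ∞) (pder i f) :=
  (hf.fderiv_right (m := (⊤ : ℕ∞)) (by simp)).clm_apply contDiff_const

theorem ContDiff.mder {n : ℕ} {V : Type*} [NormedAddCommGroup V] [NormedSpace ℝ V]
    (μ : Fin n → ℕ) {f : (Fin n → ℝ) → V} (hf : ContDiff ℝ (⊤ : ℕ∞) f) :
    ContDiff ℝ (⊤ : ℕ∞) (mder μ f) := by
  unfold _root_.mder
  induction List.finRange n with
  | nil => exact hf
  | cons i L ih =>
    rw [List.foldr_cons]
    induction μ i with
    | zero => exact ih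
    | succ k hk =>
      rw [Function.iterate_succ_apply']
      exact hk.pder i

theorem pder_eventuallyEq_zero {n : ℕ} {V : Type*} [NormedAddCommGroup V] [NormedSpace ℝ V]
    (i : Fin n) {f : (Fin n → ℝ) → V} {c : V} {x : Fin n → ℝ} (h : f =ᶠ[nhds x] fun _ => c) :
    pder i f =ᶠ[nhds x] fun _ => 0 := by
  filter_upwards [h.fderiv (𝕜 := ℝ)] with y hy
  simp [pder, hy]

theorem mder_eventuallyEq_of_const {n : ℕ} {V : Type*} [NormedAddCommGroup V] [NormedSpace ℝ V]
    (μ : Fin n → ℕ) {f : (Fin n → ℝ) → V} {c : V} {x : Fin n → ℝ}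
    (h : f =ᶠ[nhds x] fun _ => c) :
    mder μ f =ᶠ[nhds x] fun _ => if mOrder μ = 0 then c else 0 := by
  have key (L : List (Fin n)) : L.foldr (fun i g => (pder i)^[μ i] g) f =ᶠ[nhds x]
      fun _ => if (L.map μ).sum = 0 then c else 0 := by
    induction L with
    | nil => simpa using h
    | cons i L ih =>
      rw [List.foldr_cons, List.map_cons, List.sum_cons]
      induction μ i with
      | zero => simpa using ih
      | succ k hk =>
        rw [Function.iterate_succ_apply']
        have : k + 1 + (L.map μ).sum ≠ 0 := by omega
        simpa only [if_neg this] using pder_eventuallyEq_zero i hk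
  simpa [mder, mOrder, Fin.sum_univ_def] using key (List.finRange n)

/-- A smooth function that is constant outside a ball has all its derivatives bounded, even after
multiplication by a power of `1 + ‖y‖ ^ 2` of the order of the derivative. -/
theorem exists_weighted_mder_bound {n : ℕ} {V : Type*} [NormedAddCommGroup V] [NormedSpace ℝ V]
    (μ : Fin n → ℕ) {f : (Fin n → ℝ) → V} (hf : ContDiff ℝ (⊤ : ℕ∞) f) (c : V) (R : ℝ)
    (hout : ∀ y, R < ‖y‖ → f =ᶠ[nhds y] fun _ => c) :
    ∃ C, 0 ≤ C ∧ ∀ y, (1 + ‖y‖ ^ 2) ^ ((mOrder μ : ℝ) / 2) * ‖mder μ f y‖ ≤ C := by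
  have hcont : Continuous fun y : Fin n → ℝ =>
      (1 + ‖y‖ ^ 2) ^ ((mOrder μ : ℝ) / 2) * ‖mder μ f y‖ := by
    refine Continuous.mul ?_ (hf.mder μ).continuous.norm
    exact Continuous.rpow_const (by fun_prop) fun y => Or.inl (by positivity)
  obtain ⟨C, hC⟩ := (isCompact_closedBall (0 : Fin n → ℝ) R).exists_bound_of_continuousOn
    hcont.continuousOn
  refine ⟨max C ‖c‖, le_max_of_le_right (norm_nonneg c), fun y => ?_⟩
  rcases le_or_gt ‖y‖ R with hy | hy
  · exact ((le_abs_self _).trans (hC y (by simpa using hy))).trans (le_max_left _ _)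
  · rw [(mder_eventuallyEq_of_const μ (hout y hy)).self_of_nhds]
    split_ifs with h
    · simp [h]
    · simp

/-- The weight of order `m, ρ` at `x`, in terms of the rescaled point `ε • x` away from the
origin. -/
theorem symWt_mul_pow_le {n : ℕ} {m ρ r ε : ℝ} (hm : 0 < m) (hρ : ρ ≤ 1) (hr : 0 < r)
    (hε : 0 < ε) (hε1 : ε ≤ 1) (μ : Fin n → ℕ) {x : Fin n → ℝ} (hx : r ≤ ‖ε • x‖) :
    symWt m ρ μ x * ε ^ mOrder μ ≤
      (ε / r) ^ m * (1 + ‖ε • x‖ ^ 2) ^ ((mOrder μ : ℝ) / 2) := by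
  rw [norm_smul, Real.norm_of_nonneg hε.le] at *
  set k := mOrder μ
  have hb : (1 : ℝ) ≤ 1 + ‖x‖ ^ 2 := by nlinarith [sq_nonneg ‖x‖]
  have hb0 : 0 < 1 + ‖x‖ ^ 2 := by linarith
  have hdecay : (1 + ‖x‖ ^ 2) ^ (-(m / 2)) ≤ (ε / r) ^ m := by
    have h1 : (r / ε) ^ 2 ≤ 1 + ‖x‖ ^ 2 := by
      have : r / ε ≤ ‖x‖ := by rw [div_le_iff₀ hε]; linarith
      have h0 : 0 ≤ r / ε := by positivity
      nlinarith
    refine (Real.rpow_le_rpow_of_nonpos (by positivity) h1 (by linarith)).trans_eq ?_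
    rw [← Real.rpow_natCast, ← Real.rpow_mul (by positivity), ← inv_div ε r,
      Real.inv_rpow (by positivity), ← Real.rpow_neg (by positivity)]
    congr 1
    push_cast
    ring
  have hgrow : (1 + ‖x‖ ^ 2) ^ (ρ * k / 2) * ε ^ k ≤ (1 + (ε * ‖x‖) ^ 2) ^ ((k : ℝ) / 2) := by
    have hexp : ρ * k / 2 ≤ (k : ℝ) / 2 := by
      have : (0 : ℝ) ≤ k := k.cast_nonneg
      nlinarith
    have hpow : ε ^ k = (ε ^ 2) ^ ((k : ℝ) / 2) := by
      rw [← Real.rpow_natCast ε 2, ← Real.rpow_mul hε.le, ← Real.rpow_natCast]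
      congr 1
      push_cast
      ring
    calc (1 + ‖x‖ ^ 2) ^ (ρ * k / 2) * ε ^ k
        ≤ (1 + ‖x‖ ^ 2) ^ ((k : ℝ) / 2) * ε ^ k := by
          gcongr
      _ = ((1 + ‖x‖ ^ 2) * ε ^ 2) ^ ((k : ℝ) / 2) := by
          rw [hpow, Real.mul_rpow hb0.le (by positivity)]
      _ ≤ _ := by
          refine Real.rpow_le_rpow (by positivity) ?_ (by positivity)
          nlinarith
  have hsplit : symWt m ρ μ x = (1 + ‖x‖ ^ 2) ^ (-(m / 2)) * (1 + ‖x‖ ^ 2) ^ (ρ * k / 2) := by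
    rw [← Real.rpow_add hb0, symWt]
    congr 1
    ring
  rw [hsplit, mul_assoc]
  gcongr

theorem statement4 {n : ℕ} (r R : ℝ) (hr : 0 < r) (hrR : r < R)
    (χ : (Fin n → ℝ) → ℝ) (hχ : ContDiff ℝ (⊤ : ℕ∞) χ) (hχc : HasCompactSupport χ)
    (hχ1 : ∀ x : Fin n → ℝ, ‖x‖ ≤ r → χ x = 1)
    (hsupp : tsupport χ ⊆ Metric.closedBall 0 R)
    (m ρ : ℝ) (hm : 0 < m) (hρ : ρ ≤ 1) (μ : Fin n → ℕ) :
    Tendsto (fun ε : ℝ => symNorm m ρ μ (fun x => ((χ (ε • x) : ℂ) - 1)))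
      (nhdsWithin 0 (Set.Ioi 0)) (nhds 0) := by
  set G : (Fin n → ℝ) → ℂ := fun y => (χ y : ℂ) - 1 with hG
  have hGs : ContDiff ℝ (⊤ : ℕ∞) G :=
    (Complex.ofRealCLM.contDiff.comp hχ).sub contDiff_const
  have hin (y : Fin n → ℝ) (hy : ‖y‖ < r) : G =ᶠ[nhds y] fun _ => 0 := by
    filter_upwards [continuous_norm.continuousAt.eventually_lt_const hy] with z hz
    simp [hG, hχ1 z hz.le]
  have hout (y : Fin n → ℝ) (hy : R < ‖y‖) : G =ᶠ[nhds y] fun _ => -1 := by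
    have hy' : y ∉ tsupport χ := fun h => by
      have := hsupp h
      rw [mem_closedBall_zero_iff] at this
      linarith
    filter_upwards [notMem_tsupport_iff_eventuallyEq.mp hy'] with z hz
    simp [hG, hz]
  obtain ⟨C, hC0, hC⟩ := exists_weighted_mder_bound μ hGs (-1) R hout
  have hwt (x : Fin n → ℝ) : 0 ≤ symWt m ρ μ x := Real.rpow_nonneg (by positivity) _
  have hlim : Tendsto (fun ε : ℝ => (ε / r) ^ m * C) (nhdsWithin 0 (Set.Ioi 0)) (nhds 0) := by
    have : ContinuousAt (fun ε : ℝ => (ε / r) ^ m * C) 0 :=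
      ((continuousAt_id.div_const r).rpow_const (Or.inr hm.le)).mul_const C
    simpa [Real.zero_rpow hm.ne'] using this.tendsto.mono_left nhdsWithin_le_nhds
  refine squeeze_zero' (Eventually.of_forall fun ε => Real.iSup_nonneg fun x =>
    mul_nonneg (hwt x) (norm_nonneg _)) ?_ hlim
  filter_upwards [Ioc_mem_nhdsGT (zero_lt_one' ℝ)] with ε hε
  obtain ⟨hε0, hε1⟩ := hε
  refine ciSup_le fun x => ?_
  change symWt m ρ μ x * ‖mder μ (fun x => G (ε • x)) x‖ ≤ _
  rw [mder_comp_smul, Pi.smul_apply, norm_smul, Real.norm_of_nonneg (by positivity), ← mul_assoc]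
  rcases lt_or_ge ‖ε • x‖ r with hx | hx
  · rw [(mder_eventuallyEq_of_const μ (hin _ hx)).self_of_nhds]
    simp only [ite_self, norm_zero, mul_zero]
    positivity
  · calc _ ≤ (ε / r) ^ m * (1 + ‖ε • x‖ ^ 2) ^ ((mOrder μ : ℝ) / 2) * ‖mder μ G (ε • x)‖ :=
          mul_le_mul_of_nonneg_right (symWt_mul_pow_le hm hρ hr hε0 hε1 μ hx) (norm_nonneg _)
      _ ≤ _ := by
          rw [mul_assoc]
          gcongr
          exact hC _
end
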